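/- Let ρ = e^{−V} be a probability density on ℝⁿ with V : ℝⁿ → ℝ convex. For each δ > 0 there exists a unique point m_δ ∈ ℝⁿ such that ∫_{ℝⁿ} x · e^{−δ|x−m_δ|²/2} ρ(x) dx = m_δ · ∫_{ℝⁿ} e^{−δ|x−m_δ|²/2} ρ(x) dx. -/

import Mathlib

open MeasureTheory

theorem ENNReal.mul_le_sq_of_add_le_two_mul {a b d : ENNReal} (h : a + b ≤ 2 * d) :
    a * b ≤ d ^ 2 := by
  rcases eq_or_ne d ⊤ with rfl | hd
  · simp
  have hab : a + b ≠ ⊤ := ne_top_of_le_ne_top (by finiteness) h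
  have ha : a ≠ ⊤ := fun h => hab (by simp [h])
  have hb : b ≠ ⊤ := fun h => hab (by simp [h])
  lift a to NNReal using ha
  lift b to NNReal using hb
  lift d to NNReal using hd
  norm_cast at h ⊢
  have h' : (a : ℝ) + b ≤ 2 * d := by exact_mod_cast h
  have : (a : ℝ) * b ≤ d ^ 2 := by nlinarith [sq_nonneg ((a : ℝ) - b), a.2, b.2, d.2]
  exact_mod_cast this

open scoped Pointwise in
/-- Brunn–Minkowski on the line, for nonempty compact sets. -/
theorem IsCompact.volume_add_volume_le {K L C : Set ℝ} (hK : IsCompact K) (hL : IsCompact L)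
    (hK0 : K.Nonempty) (hL0 : L.Nonempty)
    (hC : ∀ x ∈ K, ∀ y ∈ L, (1 / 2 : ℝ) • (x + y) ∈ C) :
    volume K + volume L ≤ 2 * volume C := by
  obtain ⟨b, hb, hbL⟩ := hL.exists_isLeast hL0
  obtain ⟨a, ha, haK⟩ := hK.exists_isGreatest hK0
  have hsub : (fun x => b + x) '' K ∪ (fun x => a + x) '' L ⊆ (2 : ℝ) • C := by
    rintro _ (⟨x, hx, rfl⟩ | ⟨x, hx, rfl⟩)
    · exact ⟨_, hC x hx b hb, by simp; ring⟩
    · exact ⟨_, hC a ha x hx, by simp⟩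
  have hdisj : AEDisjoint volume ((fun x => b + x) '' K) ((fun x => a + x) '' L) := by
    refine measure_mono_null (t := {a + b}) ?_ (by simp)
    rintro _ ⟨⟨x, hx, rfl⟩, ⟨y, hy, hxy⟩⟩
    have h1 := haK hx
    have h2 := hbL hy
    simp only [Set.mem_singleton_iff] at *
    linarith
  have hmeas : MeasurableSet ((fun x => a + x) '' L) :=
    (hL.image (by fun_prop)).measurableSet
  calc volume K + volume L
      = volume ((fun x => b + x) '' K) + volume ((fun x => a + x) '' L) := by
        simp [measure_preimage_add]
    _ = volume ((fun x => b + x) '' K ∪ (fun x => a + x) '' L) :=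
        (measure_union₀ hmeas.nullMeasurableSet hdisj).symm
    _ ≤ volume ((2 : ℝ) • C) := measure_mono hsub
    _ = 2 * volume C := by simp [Measure.addHaar_smul]

/-- Brunn–Minkowski on the line, for nonempty measurable sets. -/
theorem MeasurableSet.volume_add_volume_le {A B C : Set ℝ} (hA : MeasurableSet A)
    (hB : MeasurableSet B) (hA0 : A.Nonempty) (hB0 : B.Nonempty)
    (hC : ∀ x ∈ A, ∀ y ∈ B, (1 / 2 : ℝ) • (x + y) ∈ C) :
    volume A + volume B ≤ 2 * volume C := by
  obtain ⟨a, ha⟩ := hA0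
  obtain ⟨b, hb⟩ := hB0
  have key : ∀ K ⊆ A, IsCompact K → ∀ L ⊆ B, IsCompact L →
      volume K + volume L ≤ 2 * volume C := by
    intro K hKA hK L hLB hL
    calc volume K + volume L ≤ volume (insert a K) + volume (insert b L) := by
          gcongr <;> exact Set.subset_insert _ _
      _ ≤ 2 * volume C := (hK.insert a).volume_add_volume_le (hL.insert b)
          (Set.insert_nonempty _ _) (Set.insert_nonempty _ _) fun x hx y hy =>
            hC x (Set.insert_subset ha hKA hx) y (Set.insert_subset hb hLB hy)
  have hsup {s : Set ℝ} (hs : MeasurableSet s) :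
      volume s = ⨆ K : {K // K ⊆ s ∧ IsCompact K}, volume K.1 := by
    rw [hs.measure_eq_iSup_isCompact, iSup_subtype]
    simp [iSup_and]
  have hne (s : Set ℝ) : Nonempty {K // K ⊆ s ∧ IsCompact K} :=
    ⟨∅, Set.empty_subset _, isCompact_empty⟩
  have := hne A
  have := hne B
  rw [hsup hA, hsup hB]
  exact ENNReal.iSup_add_iSup_le fun K L => key K K.2.1 K.2.2 L L.2.1 L.2.2

theorem lintegral_add_lintegral_le_of_forall_mul_le_sq {f g h : ℝ → ENNReal} (hf : Measurable f)
    (hg : Measurable g) (hh : Measurable h) (hf1 : (⨆ x, f x) = 1) (hg1 : (⨆ x, g x) = 1)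
    (hfg : ∀ x y, f x * g y ≤ h ((1 / 2 : ℝ) • (x + y)) ^ 2) :
    (∫⁻ x, f x) + ∫⁻ x, g x ≤ 2 * ∫⁻ x, h x := by
  have layer {u : ℝ → ENNReal} (hu : Measurable u) (hu1 : ∀ x, u x ≤ 1) :
      ∫⁻ x, u x = ∫⁻ t in Set.Ioi (0 : ℝ), volume {x | ENNReal.ofReal t < u x} := by
    have hfin x : u x ≠ ⊤ := ne_top_of_le_ne_top ENNReal.one_ne_top (hu1 x)
    calc ∫⁻ x, u x = ∫⁻ x, ENNReal.ofReal (u x).toReal := by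
          simp [ENNReal.ofReal_toReal (hfin _)]
      _ = ∫⁻ t in Set.Ioi (0 : ℝ), volume {x | t < (u x).toReal} :=
          lintegral_eq_lintegral_meas_lt _ (.of_forall fun _ => ENNReal.toReal_nonneg)
            hu.ennreal_toReal.aemeasurable
      _ = _ := setLIntegral_congr_fun measurableSet_Ioi fun t ht => by
          simp only [ENNReal.ofReal_lt_iff_lt_toReal (Set.mem_Ioi.1 ht).le (hfin _)]
  have hf1' x : f x ≤ 1 := hf1 ▸ le_iSup f x
  have hg1' x : g x ≤ 1 := hg1 ▸ le_iSup g x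
  have hmeas {u : ℝ → ENNReal} (hu : Measurable u) (t : ℝ) :
      MeasurableSet {x | ENNReal.ofReal t < u x} := measurableSet_lt measurable_const hu
  have hlevel (u : ℝ → ENNReal) : Measurable fun t : ℝ => volume {x | ENNReal.ofReal t < u x} :=
    Antitone.measurable fun s t hst => measure_mono fun x hx =>
      (ENNReal.ofReal_le_ofReal hst).trans_lt hx
  calc (∫⁻ x, f x) + ∫⁻ x, g x
      = ∫⁻ t in Set.Ioi (0 : ℝ), (volume {x | ENNReal.ofReal t < f x}
          + volume {x | ENNReal.ofReal t < g x}) := by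
        rw [layer hf hf1', layer hg hg1', lintegral_add_left (hlevel f)]
    _ ≤ ∫⁻ t in Set.Ioi (0 : ℝ), 2 * volume {x | ENNReal.ofReal t < min (h x) 1} := by
        refine setLIntegral_mono ((hlevel _).const_mul 2) fun t ht => ?_
        rcases lt_or_ge (ENNReal.ofReal t) 1 with ht1 | ht1
        · refine (hmeas hf t).volume_add_volume_le (hmeas hg t)
            (lt_iSup_iff.1 (hf1.symm ▸ ht1) : ∃ x, ENNReal.ofReal t < f x)
            (lt_iSup_iff.1 (hg1.symm ▸ ht1) : ∃ x, ENNReal.ofReal t < g x) fun x hx y hy => ?_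
          refine lt_min ?_ ht1
          have : ENNReal.ofReal t ^ 2 < h ((1 / 2 : ℝ) • (x + y)) ^ 2 := by
            refine lt_of_lt_of_le ?_ (hfg x y)
            rw [sq]
            exact ENNReal.mul_lt_mul hx hy
          exact lt_of_pow_lt_pow_left' 2 this
        · have hempty {u : ℝ → ENNReal} (hu : ∀ x, u x ≤ 1) :
              {x | ENNReal.ofReal t < u x} = ∅ := by
            ext x
            simpa using (hu x).trans ht1
          simp [hempty hf1', hempty hg1']
    _ = 2 * ∫⁻ x, min (h x) 1 := by
        rw [lintegral_const_mul _ (hlevel _), layer (hh.min measurable_const)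
          fun x => min_le_right _ _]
    _ ≤ 2 * ∫⁻ x, h x := by
        gcongr
        exact min_le_left _ _

/-- The midpoint Prékopa–Leindler inequality for a measure `μ`. -/
def MidpointPrekopaLeindler {E : Type*} [AddCommGroup E] [Module ℝ E] [MeasurableSpace E]
    (μ : Measure E) : Prop :=
  ∀ ⦃f g h : E → ENNReal⦄, Measurable f → Measurable g → Measurable h →
    (∀ x y, f x * g y ≤ h ((1 / 2 : ℝ) • (x + y)) ^ 2) →
    (∫⁻ x, f x ∂μ) * ∫⁻ x, g x ∂μ ≤ (∫⁻ x, h x ∂μ) ^ 2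

theorem lintegral_mul_lintegral_le_sq_of_iSup_ne_top {f g h : ℝ → ENNReal} (hf : Measurable f)
    (hg : Measurable g) (hh : Measurable h) (hfs : (⨆ x, f x) ≠ ⊤) (hgs : (⨆ x, g x) ≠ ⊤)
    (hfg : ∀ x y, f x * g y ≤ h ((1 / 2 : ℝ) • (x + y)) ^ 2) :
    (∫⁻ x, f x) * ∫⁻ x, g x ≤ (∫⁻ x, h x) ^ 2 := by
  rcases eq_or_ne (⨆ x, f x) 0 with hf0 | hf0
  · simp [show f = 0 from funext (by simpa using hf0)]
  rcases eq_or_ne (⨆ x, g x) 0 with hg0 | hg0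
  · simp [show g = 0 from funext (by simpa using hg0)]
  set M := ⨆ x, f x with hM
  set N := ⨆ x, g x with hN
  obtain ⟨c, hc⟩ : ∃ c : ENNReal, c ^ 2 = M⁻¹ * N⁻¹ :=
    ⟨(M⁻¹ * N⁻¹) ^ (1 / 2 : ℝ), by rw [← ENNReal.rpow_natCast, ← ENNReal.rpow_mul]; norm_num⟩
  have hnorm := lintegral_add_lintegral_le_of_forall_mul_le_sq (hf.const_mul M⁻¹)
    (hg.const_mul N⁻¹) (hh.const_mul c)
    (by rw [← ENNReal.mul_iSup, ← hM, ENNReal.inv_mul_cancel hf0 hfs])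
    (by rw [← ENNReal.mul_iSup, ← hN, ENNReal.inv_mul_cancel hg0 hgs])
    fun x y => by
      rw [mul_pow, hc, mul_mul_mul_comm]
      gcongr
      exact hfg x y
  rw [lintegral_const_mul _ hf, lintegral_const_mul _ hg, lintegral_const_mul _ hh] at hnorm
  have hmul := ENNReal.mul_le_sq_of_add_le_two_mul hnorm
  rw [mul_pow, hc, mul_mul_mul_comm] at hmul
  refine (ENNReal.mul_le_mul_iff_right ?_ ?_).1 hmul
  · simp [hfs, hgs]
  · exact ENNReal.mul_ne_top (by simpa) (by simpa)

theorem midpointPrekopaLeindler_real : MidpointPrekopaLeindler (volume : Measure ℝ) := by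
  intro f g h hf hg hh hfg
  have trunc {u : ℝ → ENNReal} (hu : Measurable u) :
      ∫⁻ x, u x = ⨆ k : ℕ, ∫⁻ x, min (u x) k := by
    rw [← lintegral_iSup (fun k => hu.min measurable_const)
      fun i j hij x => min_le_min_left _ (by exact_mod_cast hij)]
    congr with x
    rw [← inf_iSup_eq, ENNReal.iSup_natCast, inf_top_eq]
  rw [trunc hf, trunc hg]
  simp_rw [ENNReal.iSup_mul, ENNReal.mul_iSup]
  refine iSup₂_le fun k l => ?_
  refine lintegral_mul_lintegral_le_sq_of_iSup_ne_top (hf.min measurable_const)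
    (hg.min measurable_const) hh ?_ ?_ fun x y => le_trans ?_ (hfg x y)
  · exact ne_top_of_le_ne_top (ENNReal.natCast_ne_top k) (iSup_le fun x => min_le_right _ _)
  · exact ne_top_of_le_ne_top (ENNReal.natCast_ne_top l) (iSup_le fun x => min_le_right _ _)
  · gcongr <;> exact min_le_left _ _

namespace MidpointPrekopaLeindler

variable {E F : Type*} [AddCommGroup E] [Module ℝ E] [MeasurableSpace E]
  [AddCommGroup F] [Module ℝ F] [MeasurableSpace F]

theorem prod {μ : Measure E} {ν : Measure F} [SFinite ν] (hμ : MidpointPrekopaLeindler μ)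
    (hν : MidpointPrekopaLeindler ν) : MidpointPrekopaLeindler (μ.prod ν) := by
  intro f g h hf hg hh hfg
  rw [lintegral_prod _ hf.aemeasurable, lintegral_prod _ hg.aemeasurable,
    lintegral_prod _ hh.aemeasurable]
  refine hμ hf.lintegral_prod_right' hg.lintegral_prod_right' hh.lintegral_prod_right'
    fun s t => ?_
  exact hν (hf.comp measurable_prodMk_left) (hg.comp measurable_prodMk_left)
    (hh.comp measurable_prodMk_left) fun x y => hfg (s, x) (t, y)

theorem of_measurePreserving {μ : Measure E} {ν : Measure F} (hν : MidpointPrekopaLeindler ν)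
    (e : E →ₗ[ℝ] F) (e' : F →ₗ[ℝ] E) (hee : ∀ x, e' (e x) = x) (he : MeasurePreserving e μ ν)
    (he' : Measurable e') : MidpointPrekopaLeindler μ := by
  intro f g h hf hg hh hfg
  have hcomp {u : E → ENNReal} (hu : Measurable u) : ∫⁻ x, u x ∂μ = ∫⁻ y, u (e' y) ∂ν := by
    simpa [hee] using he.lintegral_comp (hu.comp he')
  rw [hcomp hf, hcomp hg, hcomp hh]
  exact hν (hf.comp he') (hg.comp he') (hh.comp he') fun x y => by
    simpa using hfg (e' x) (e' y)

theorem pi : ∀ n : ℕ, MidpointPrekopaLeindler (volume : Measure (Fin n → ℝ))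
  | 0 => fun f g h _ _ _ hfg => by
    have hvol : (volume : Measure (Fin 0 → ℝ)) Set.univ = 1 := by simp [volume_pi]
    simp only [lintegral_unique, hvol, mul_one]
    exact (hfg _ _).trans_eq (congrArg (h · ^ 2) (Subsingleton.elim _ _))
  | n + 1 => (midpointPrekopaLeindler_real.prod (pi n)).of_measurePreserving
      ((LinearMap.proj 0).prod (LinearMap.funLeft ℝ ℝ Fin.succ))
      { toFun := fun p => Fin.cons p.1 p.2
        map_add' := fun p q => by ext i; cases i using Fin.cases <;> simp
        map_smul' := fun c p => by ext i; cases i using Fin.cases <;> simp }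
      (fun x => by ext i; cases i using Fin.cases <;> simp [LinearMap.funLeft])
      (volume_preserving_piFinSuccAbove (fun _ => ℝ) 0)
      (by
        refine measurable_pi_lambda _ fun i => ?_
        cases i using Fin.cases with
        | zero => exact measurable_fst
        | succ i => exact (measurable_pi_apply i).comp measurable_snd)

theorem euclideanSpace (n : ℕ) :
    MidpointPrekopaLeindler (volume : Measure (EuclideanSpace ℝ (Fin n))) :=
  (pi n).of_measurePreserving (WithLp.linearEquiv 2 ℝ (Fin n → ℝ)).toLinearMap
    (WithLp.linearEquiv 2 ℝ (Fin n → ℝ)).symm.toLinearMap (fun _ => rfl)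
    (EuclideanSpace.volume_preserving_symm_measurableEquiv_toLp (Fin n))
    (MeasurableEquiv.toLp 2 (Fin n → ℝ)).measurable

end MidpointPrekopaLeindler

theorem tendsto_half_pow_nhdsNE :
    Filter.Tendsto (fun k : ℕ => (1 / 2 : ℝ) ^ k) Filter.atTop (nhdsWithin 0 {0}ᶜ) :=
  tendsto_nhdsWithin_iff.2 ⟨tendsto_pow_atTop_nhds_zero_of_lt_one (by norm_num) (by norm_num),
    .of_forall fun k => by simp⟩

theorem HasDerivAt.le_of_mul_le_sq_half {f : ℝ → ℝ} (hf : ∀ t, 0 < f t)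
    (hmid : ∀ t, f 0 * f t ≤ f (t / 2) ^ 2) (hf' : HasDerivAt f 0 0) (t : ℝ) : f t ≤ f 0 := by
  set ψ : ℝ → ℝ := fun s => Real.log (f (s * t)) - Real.log (f 0) with hψ
  have hderiv : HasDerivAt ψ 0 0 := by
    have h1 : HasDerivAt (fun s : ℝ => s * t) t 0 := by
      simpa using (hasDerivAt_id (0 : ℝ)).mul_const t
    have h2 : HasDerivAt (fun s : ℝ => f (s * t)) (0 * t) 0 :=
      HasDerivAt.comp (0 : ℝ) (by simpa using hf') h1
    simpa [hψ] using (h2.log (hf _).ne').sub_const (Real.log (f 0))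
  have hhalf s : ψ s ≤ 2 * ψ (s / 2) := by
    have h := Real.log_le_log (mul_pos (hf 0) (hf (s * t))) (hmid (s * t))
    rw [Real.log_mul (hf _).ne' (hf _).ne', Real.log_pow] at h
    simp only [hψ, show s / 2 * t = s * t / 2 by ring]
    push_cast at h
    linarith
  have hpow (k : ℕ) : ψ 1 ≤ ((1 / 2 : ℝ) ^ k)⁻¹ • (ψ (0 + (1 / 2 : ℝ) ^ k) - ψ 0) := by
    have h0 : ψ 0 = 0 := by simp [hψ]
    rw [h0, zero_add, sub_zero, smul_eq_mul]
    induction k with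
    | zero => simp
    | succ k ih =>
      refine ih.trans ?_
      rw [pow_succ, mul_inv, mul_assoc]
      gcongr
      simpa [div_eq_mul_inv] using hhalf ((1 / 2 : ℝ) ^ k)
  have hlim := (hasDerivAt_iff_tendsto_slope_zero.1 hderiv).comp tendsto_half_pow_nhdsNE
  have : ψ 1 ≤ 0 := ge_of_tendsto' hlim hpow
  simp only [hψ, one_mul, sub_nonpos] at this
  exact (Real.log_le_log_iff (hf _) (hf _)).1 this

/-- The density `ρ` multiplied by an unnormalised Gaussian of inverse variance `δ` centred
at `m`. -/
noncomputable def gaussianReweight {E : Type*} [NormedAddCommGroup E] (δ : ℝ) (ρ : E → ℝ)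
    (m x : E) : ℝ :=
  Real.exp (-(δ * ‖x - m‖ ^ 2 / 2)) * ρ x

section GaussianReweight

open Real ProbabilityTheory

variable {E : Type*} [NormedAddCommGroup E] {δ : ℝ} {ρ : E → ℝ}

theorem gaussianReweight_pos (hρ : ∀ x, 0 < ρ x) (m x : E) : 0 < gaussianReweight δ ρ m x :=
  mul_pos (exp_pos _) (hρ x)

theorem gaussianReweight_le (hδ : 0 < δ) (hρ : ∀ x, 0 < ρ x) (m x : E) :
    gaussianReweight δ ρ m x ≤ ρ x :=
  mul_le_of_le_one_left (hρ x).le (exp_le_one_iff.2 (by simp only [neg_nonpos]; positivity))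

theorem Continuous.gaussianReweight (hρ : Continuous ρ) (m : E) :
    Continuous (gaussianReweight δ ρ m) := by
  unfold _root_.gaussianReweight
  fun_prop

variable [InnerProductSpace ℝ E]

theorem gaussianReweight_add_smul (m e x : E) (t : ℝ) :
    gaussianReweight δ ρ (m + t • e) x =
      exp (-(δ * ‖e‖ ^ 2 / 2) * t ^ 2) *
        (gaussianReweight δ ρ m x * exp (t * (δ * inner ℝ e (x - m)))) := by
  have h : ‖x - (m + t • e)‖ ^ 2 = ‖x - m‖ ^ 2 - 2 * t * inner ℝ e (x - m) + t ^ 2 * ‖e‖ ^ 2 := by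
    rw [← sub_sub, norm_sub_sq_real, inner_smul_right, norm_smul, mul_pow, real_inner_comm,
      norm_eq_abs, sq_abs]
    ring
  simp only [gaussianReweight, h]
  rw [mul_right_comm (exp _) (ρ x), ← mul_assoc (exp _), ← exp_add, ← exp_add]
  congr 2
  ring

theorem gaussianReweight_mul_le_sq (hδ : 0 < δ) {V : E → ℝ} (hV : ConvexOn ℝ Set.univ V)
    (m m' x y : E) :
    gaussianReweight δ (fun z => exp (-V z)) m x * gaussianReweight δ (fun z => exp (-V z)) m' y ≤
      gaussianReweight δ (fun z => exp (-V z)) ((1 / 2 : ℝ) • (m + m'))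
        ((1 / 2 : ℝ) • (x + y)) ^ 2 := by
  simp only [gaussianReweight, ← exp_add, ← exp_nat_mul]
  rw [exp_le_exp]
  have hVmid : V ((1 / 2 : ℝ) • x + (1 / 2 : ℝ) • y) ≤ (1 / 2 : ℝ) • V x + (1 / 2 : ℝ) • V y :=
    hV.2 (Set.mem_univ x) (Set.mem_univ y) (by norm_num) (by norm_num) (by norm_num)
  rw [← smul_add] at hVmid
  have hnorm : 2 * ‖(1 / 2 : ℝ) • (x + y) - (1 / 2 : ℝ) • (m + m')‖ ^ 2 ≤
      ‖x - m‖ ^ 2 + ‖y - m'‖ ^ 2 := by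
    have := parallelogram_law_with_norm ℝ (x - m) (y - m')
    rw [← smul_sub, norm_smul, show x + y - (m + m') = x - m + (y - m') by abel, mul_pow]
    norm_num
    nlinarith [sq_nonneg ‖x - m - (y - m')‖]
  simp only [smul_eq_mul] at hVmid
  push_cast
  nlinarith

variable [MeasurableSpace E] [BorelSpace E] {μ : Measure E}

omit [InnerProductSpace ℝ E] in
theorem integrable_gaussianReweight (hδ : 0 < δ) (hρ : ∀ x, 0 < ρ x) (hρc : Continuous ρ)
    (hρi : Integrable ρ μ) (m : E) : Integrable (gaussianReweight δ ρ m) μ :=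
  hρi.mono (hρc.gaussianReweight m).measurable.aestronglyMeasurable <| .of_forall fun x => by
    rw [norm_of_nonneg (gaussianReweight_pos hρ m x).le, norm_of_nonneg (hρ x).le]
    exact gaussianReweight_le hδ hρ m x

theorem integrable_gaussianReweight_smul_sub [FiniteDimensional ℝ E] (hδ : 0 < δ)
    (hρ : ∀ x, 0 < ρ x) (hρc : Continuous ρ) (hρi : Integrable ρ μ) (m : E) :
    Integrable (fun x => gaussianReweight δ ρ m x • (x - m)) μ := by
  refine (hρi.const_mul (1 + 2 / δ)).mono
    ((hρc.gaussianReweight m).smul (by fun_prop)).aestronglyMeasurable <| .of_forall fun x => ?_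
  rw [norm_smul, norm_of_nonneg (gaussianReweight_pos hρ m x).le,
    norm_of_nonneg (mul_nonneg (by positivity) (hρ x).le), gaussianReweight, mul_right_comm]
  refine mul_le_mul_of_nonneg_right ?_ (hρ x).le
  set r := ‖x - m‖
  have h1 := add_one_le_exp (δ * r ^ 2 / 2)
  rw [exp_neg, inv_mul_le_iff₀ (exp_pos _)]
  have h2 : r ≤ (δ * r ^ 2 / 2 + 1) * (1 + 2 / δ) := by
    have : (δ * r ^ 2 / 2 + 1) * (1 + 2 / δ) = δ * r ^ 2 / 2 + 1 + r ^ 2 + 2 / δ := by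
      field_simp
      ring
    rw [this]
    have : 0 < 2 / δ := by positivity
    nlinarith [sq_nonneg (r - 1), mul_nonneg hδ.le (sq_nonneg r)]
  exact h2.trans (by gcongr)

omit [InnerProductSpace ℝ E] in
theorem continuous_integral_gaussianReweight (hδ : 0 < δ) (hρ : ∀ x, 0 < ρ x)
    (hρc : Continuous ρ) (hρi : Integrable ρ μ) :
    Continuous fun m => ∫ x, gaussianReweight δ ρ m x ∂μ := by
  refine continuous_of_dominated
    (fun m => (integrable_gaussianReweight hδ hρ hρc hρi m).aestronglyMeasurable)
    (fun m => .of_forall fun x => ?_) hρi (.of_forall fun x => ?_)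
  · rw [norm_of_nonneg (gaussianReweight_pos hρ m x).le]
    exact gaussianReweight_le hδ hρ m x
  · unfold gaussianReweight
    fun_prop

omit [InnerProductSpace ℝ E] in
theorem tendsto_integral_gaussianReweight_cobounded (hδ : 0 < δ) (hρ : ∀ x, 0 < ρ x)
    (hρc : Continuous ρ) (hρi : Integrable ρ μ) :
    Filter.Tendsto (fun m => ∫ x, gaussianReweight δ ρ m x ∂μ) (Bornology.cobounded E)
      (nhds 0) := by
  rw [← comap_norm_atTop, ← integral_zero E ℝ (μ := μ)]
  refine tendsto_integral_filter_of_dominated_convergence ρ (.of_forall fun m =>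
      (integrable_gaussianReweight hδ hρ hρc hρi m).aestronglyMeasurable)
    (.of_forall fun m => .of_forall fun x => ?_) hρi (.of_forall fun x => ?_)
  · rw [norm_of_nonneg (gaussianReweight_pos hρ m x).le]
    exact gaussianReweight_le hδ hρ m x
  · rw [comap_norm_atTop]
    have h1 : Filter.Tendsto (fun m => ‖x - m‖) (Bornology.cobounded E) Filter.atTop := by
      refine Filter.tendsto_atTop_mono (fun m => ?_)
        (Filter.tendsto_atTop_add_const_right _ (-‖x‖) tendsto_norm_cobounded_atTop)
      have := norm_sub_norm_le m x
      rw [norm_sub_rev]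
      linarith
    have h2 : Filter.Tendsto (fun m => δ * ‖x - m‖ ^ 2 / 2) (Bornology.cobounded E)
        Filter.atTop :=
      (((Filter.tendsto_pow_atTop two_ne_zero).comp h1).const_mul_atTop hδ).atTop_div_const
        two_pos
    simpa [gaussianReweight] using
      (tendsto_exp_atBot.comp (Filter.tendsto_neg_atTop_atBot.comp h2)).mul_const (ρ x)

omit [InnerProductSpace ℝ E] in
theorem integral_gaussianReweight_pos [NeZero μ] (hδ : 0 < δ) (hρ : ∀ x, 0 < ρ x)
    (hρc : Continuous ρ) (hρi : Integrable ρ μ) (m : E) :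
    0 < ∫ x, gaussianReweight δ ρ m x ∂μ := by
  rw [integral_pos_iff_support_of_nonneg (fun x => (gaussianReweight_pos hρ m x).le)
    (integrable_gaussianReweight hδ hρ hρc hρi m)]
  have : Function.support (gaussianReweight δ ρ m) = Set.univ :=
    Set.eq_univ_of_forall fun x => (gaussianReweight_pos hρ m x).ne'
  rw [this]
  exact NeZero.pos _

omit [InnerProductSpace ℝ E] in
theorem integral_withDensity_gaussianReweight (hρ : ∀ x, 0 < ρ x) (hρc : Continuous ρ) (m : E)
    (g : E → ℝ) :
    ∫ x, g x ∂(μ.withDensity fun x => ENNReal.ofReal (gaussianReweight δ ρ m x)) =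
      ∫ x, gaussianReweight δ ρ m x * g x ∂μ := by
  rw [integral_withDensity_eq_integral_toReal_smul
    (hρc.gaussianReweight m).measurable.ennreal_ofReal (by simp)]
  simp [(gaussianReweight_pos hρ m _).le]

theorem integral_gaussianReweight_add_smul (hρ : ∀ x, 0 < ρ x) (hρc : Continuous ρ)
    (m e : E) (t : ℝ) :
    ∫ x, gaussianReweight δ ρ (m + t • e) x ∂μ =
      exp (-(δ * ‖e‖ ^ 2 / 2) * t ^ 2) * mgf (fun x => δ * inner ℝ e (x - m))
        (μ.withDensity fun x => ENNReal.ofReal (gaussianReweight δ ρ m x)) t := by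
  simp_rw [gaussianReweight_add_smul, integral_const_mul, mgf,
    integral_withDensity_gaussianReweight hρ hρc]

theorem integrableExpSet_gaussianReweight (hδ : 0 < δ) (hρ : ∀ x, 0 < ρ x) (hρc : Continuous ρ)
    (hρi : Integrable ρ μ) (m e : E) :
    integrableExpSet (fun x => δ * inner ℝ e (x - m))
      (μ.withDensity fun x => ENNReal.ofReal (gaussianReweight δ ρ m x)) = Set.univ := by
  refine Set.eq_univ_of_forall fun t => ?_
  rw [integrableExpSet, Set.mem_ofPred_eq, integrable_withDensity_iff_integrable_smul'
    (hρc.gaussianReweight m).measurable.ennreal_ofReal (by simp)]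
  have h := integrable_gaussianReweight hδ hρ hρc hρi (m + t • e)
  rw [show gaussianReweight δ ρ (m + t • e) = _ from
      funext (gaussianReweight_add_smul m e · t),
    integrable_const_mul_iff (exp_ne_zero _).isUnit] at h
  simpa [(gaussianReweight_pos hρ m _).le] using h

theorem analyticOnNhd_integral_gaussianReweight (hδ : 0 < δ) (hρ : ∀ x, 0 < ρ x)
    (hρc : Continuous ρ) (hρi : Integrable ρ μ) (m e : E) :
    AnalyticOnNhd ℝ (fun t : ℝ => ∫ x, gaussianReweight δ ρ (m + t • e) x ∂μ) Set.univ := by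
  rw [funext (integral_gaussianReweight_add_smul hρ hρc m e)]
  have := analyticOnNhd_mgf (X := fun x => δ * inner ℝ e (x - m))
    (μ := μ.withDensity fun x => ENNReal.ofReal (gaussianReweight δ ρ m x))
  rw [integrableExpSet_gaussianReweight hδ hρ hρc hρi, interior_univ] at this
  exact AnalyticOnNhd.mul (fun t _ => by fun_prop) this

theorem hasDerivAt_integral_gaussianReweight [FiniteDimensional ℝ E] (hδ : 0 < δ)
    (hρ : ∀ x, 0 < ρ x) (hρc : Continuous ρ) (hρi : Integrable ρ μ) (m e : E) :
    HasDerivAt (fun t : ℝ => ∫ x, gaussianReweight δ ρ (m + t • e) x ∂μ)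
      (δ * inner ℝ e (∫ x, gaussianReweight δ ρ m x • (x - m) ∂μ)) 0 := by
  rw [funext (integral_gaussianReweight_add_smul hρ hρc m e)]
  have h1 := hasDerivAt_mgf (t := 0) (X := fun x => δ * inner ℝ e (x - m))
    (μ := μ.withDensity fun x => ENNReal.ofReal (gaussianReweight δ ρ m x))
    (by simp [integrableExpSet_gaussianReweight hδ hρ hρc hρi])
  have h2 : HasDerivAt (fun t : ℝ => exp (-(δ * ‖e‖ ^ 2 / 2) * t ^ 2)) 0 0 := by
    simpa using (((hasDerivAt_id (0 : ℝ)).pow 2).const_mul (-(δ * ‖e‖ ^ 2 / 2))).exp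
  refine (h2.mul h1).congr_deriv ?_
  rw [integral_withDensity_gaussianReweight hρ hρc,
    ← integral_inner (integrable_gaussianReweight_smul_sub hδ hρ hρc hρi m)]
  simp [inner_smul_right, mul_left_comm, integral_const_mul]

theorem integral_smul_eq_iff [FiniteDimensional ℝ E] (hδ : 0 < δ)
    (hρ : ∀ x, 0 < ρ x) (hρc : Continuous ρ) (hρi : Integrable ρ μ) (m : E) :
    ∫ x, gaussianReweight δ ρ m x • x ∂μ = (∫ x, gaussianReweight δ ρ m x ∂μ) • m ↔
      ∫ x, gaussianReweight δ ρ m x • (x - m) ∂μ = 0 := by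
  have h1 := integrable_gaussianReweight_smul_sub hδ hρ hρc hρi m
  have h2 := (integrable_gaussianReweight hδ hρ hρc hρi m).smul_const m
  have h3 : ∫ x, gaussianReweight δ ρ m x • x ∂μ =
      (∫ x, gaussianReweight δ ρ m x • (x - m) ∂μ) + (∫ x, gaussianReweight δ ρ m x ∂μ) • m := by
    rw [← integral_smul_const, ← integral_add h1 h2]
    simp [← smul_add]
  rw [h3, add_eq_right]

theorem integral_gaussianReweight_mul_le_sq (hμ : MidpointPrekopaLeindler μ) (hδ : 0 < δ)
    {V : E → ℝ} (hV : ConvexOn ℝ Set.univ V) (hVc : Continuous V)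
    (hVi : Integrable (fun x => exp (-V x)) μ) (m m' : E) :
    (∫ x, gaussianReweight δ (fun z => exp (-V z)) m x ∂μ) *
        ∫ x, gaussianReweight δ (fun z => exp (-V z)) m' x ∂μ ≤
      (∫ x, gaussianReweight δ (fun z => exp (-V z)) ((1 / 2 : ℝ) • (m + m')) x ∂μ) ^ 2 := by
  have hpos : ∀ x, 0 < exp (-V x) := fun x => exp_pos _
  have hcont : Continuous fun x => exp (-V x) := by fun_prop
  have hnn m x := (gaussianReweight_pos (δ := δ) hpos m x).le
  have hmeas m : Measurable fun x =>
      ENNReal.ofReal (gaussianReweight δ (fun z => exp (-V z)) m x) :=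
    (hcont.gaussianReweight m).measurable.ennreal_ofReal
  have h := hμ (hmeas m) (hmeas m') (hmeas ((1 / 2 : ℝ) • (m + m'))) fun x y => by
    rw [← ENNReal.ofReal_mul (hnn _ _), ← ENNReal.ofReal_pow (hnn _ _)]
    exact ENNReal.ofReal_le_ofReal (gaussianReweight_mul_le_sq hδ hV m m' x y)
  have hlint m := (ofReal_integral_eq_lintegral_ofReal
    (integrable_gaussianReweight hδ hpos hcont hVi m) (.of_forall (hnn m))).symm
  rw [hlint, hlint, hlint, ← ENNReal.ofReal_mul (integral_nonneg (hnn _)),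
    ← ENNReal.ofReal_pow (integral_nonneg (hnn _))] at h
  exact (ENNReal.ofReal_le_ofReal_iff (by positivity)).1 h

end GaussianReweight

/-- **Existence and uniqueness of the Gaussian-reweighted barycenter fixed point.**
For a log-concave probability density `ρ = e^{-V}` on `ℝⁿ` and `δ > 0`, there is a unique
`m_δ ∈ ℝⁿ` with `∫ x e^{-δ|x-m_δ|²/2} ρ(x) dx = m_δ ∫ e^{-δ|x-m_δ|²/2} ρ(x) dx`. -/
theorem exists_unique_reweighted_barycenter
    {n : ℕ} (V : EuclideanSpace ℝ (Fin n) → ℝ) (hV : ConvexOn ℝ Set.univ V)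
    (hρ : (∫ x, Real.exp (-V x)) = 1)
    (δ : ℝ) (hδ : 0 < δ) :
    ∃! m : EuclideanSpace ℝ (Fin n),
      (∫ x, (Real.exp (-(δ * ‖x - m‖ ^ 2 / 2)) * Real.exp (-V x)) • x) =
        (∫ x, Real.exp (-(δ * ‖x - m‖ ^ 2 / 2)) * Real.exp (-V x)) • m := by
  set ρ : EuclideanSpace ℝ (Fin n) → ℝ := fun x => Real.exp (-V x) with hρ_def
  have hVc : Continuous V := continuousOn_univ.1 (hV.continuousOn isOpen_univ)
  have hρc : Continuous ρ := by fun_prop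
  have hρ0 : ∀ x, 0 < ρ x := fun x => Real.exp_pos _
  have hρi : Integrable ρ := .of_integral_ne_zero (by rw [hρ]; exact one_ne_zero)
  set F : EuclideanSpace ℝ (Fin n) → ℝ := fun m => ∫ x, gaussianReweight δ ρ m x with hF
  have hF0 : ∀ m, 0 < F m := integral_gaussianReweight_pos hδ hρ0 hρc hρi
  have hFlim : Filter.Tendsto F (Bornology.cobounded _) (nhds 0) :=
    tendsto_integral_gaussianReweight_cobounded hδ hρ0 hρc hρi
  have hFmid : ∀ m m', F m * F m' ≤ F ((1 / 2 : ℝ) • (m + m')) ^ 2 :=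
    integral_gaussianReweight_mul_le_sq (.euclideanSpace n) hδ hV hVc hρi
  have hderiv := hasDerivAt_integral_gaussianReweight (μ := volume) hδ hρ0 hρc hρi
  have hmax (m) (hm : ∫ x, gaussianReweight δ ρ m x • (x - m) = 0) (y) : F y ≤ F m := by
    have h := HasDerivAt.le_of_mul_le_sq_half (f := fun t : ℝ => F (m + t • (y - m)))
      (fun t => hF0 _) (fun t => ?_) (by simpa [hm] using hderiv m (y - m)) 1
    · simpa using h
    · convert hFmid (m + (0 : ℝ) • (y - m)) (m + t • (y - m)) using 3
      module
  refine (existsUnique_congr fun m => integral_smul_eq_iff hδ hρ0 hρc hρi m).2 ?_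
  refine existsUnique_of_exists_of_unique ?_ fun m m' hm hm' => ?_
  · obtain ⟨m, hm⟩ := (continuous_integral_gaussianReweight hδ hρ0 hρc hρi).exists_forall_ge'
      (0 : EuclideanSpace ℝ (Fin n)) <| by
        rw [← Metric.cobounded_eq_cocompact]
        exact (hFlim.eventually_lt_const (hF0 0)).mono fun _ h => h.le
    refine ⟨m, inner_self_eq_zero (𝕜 := ℝ).1 ?_⟩
    have hloc : IsLocalMax (fun t : ℝ => F (m + t • ∫ x, gaussianReweight δ ρ m x • (x - m))) 0 :=
      .of_forall fun t => by simpa using hm _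
    simpa [hδ.ne'] using hloc.hasDerivAt_eq_zero (hderiv m _)
  · by_contra hne
    set e := m' - m with he
    have he0 : e ≠ 0 := sub_ne_zero.2 (Ne.symm hne)
    have hpow (k : ℕ) : F (m + (1 / 2 : ℝ) ^ k • e) = F m := by
      refine (hmax m hm _).antisymm ?_
      induction k with
      | zero => simpa [he] using hmax m' hm' m
      | succ k ih =>
        refine le_of_sq_le_sq ?_ (hF0 _).le
        calc F m ^ 2 ≤ F m * F (m + (1 / 2 : ℝ) ^ k • e) := by
              rw [sq]; exact mul_le_mul_of_nonneg_left ih (hF0 m).le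
          _ ≤ _ := hFmid _ _
          _ = _ := by congr 2; rw [pow_succ]; module
    have hconst : (fun t : ℝ => F (m + t • e)) = fun _ => F m :=
      (analyticOnNhd_integral_gaussianReweight hδ hρ0 hρc hρi m e).eq_of_frequently_eq
        (z₀ := 0) (fun t _ => analyticAt_const)
        (tendsto_half_pow_nhdsNE.frequently (.of_forall hpow))
    have hline : Filter.Tendsto (fun t : ℝ => m + t • e) Filter.atTop
        (Bornology.cobounded _) := by
      rw [← tendsto_norm_atTop_iff_cobounded]
      refine Filter.tendsto_atTop_mono (fun t => ?_) (Filter.tendsto_atTop_add_const_right _ (-‖m‖)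
        (Filter.tendsto_id.atTop_mul_const (norm_pos_iff.2 he0)))
      have h1 := norm_sub_norm_le (t • e) (-m)
      rw [sub_neg_eq_add, norm_neg, norm_smul, add_comm (t • e)] at h1
      have h2 := mul_le_mul_of_nonneg_right (Real.le_norm_self t) (norm_nonneg e)
      simp only [id]
      linarith
    have hlim := hFlim.comp hline
    rw [show F ∘ (fun t : ℝ => m + t • e) = fun _ => F m from hconst] at hlim
    exact (hF0 m).ne' (tendsto_nhds_unique tendsto_const_nhds hlim)
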